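/- Hardy–Poincaré inequality with degenerate weight: Assume p ∈ C([0,1]), p > 0 on [0,1]\{x₀}, p(x₀) = 0 for some x₀ ∈ (0,1), and there exists q ∈ (1,2) such that x ↦ p(x)/|x-x₀|^q is nonincreasing on [0,x₀) and nondecreasing on (x₀,1]. Then there exists a constant C > 0 such that for every function w that is locally absolutely continuous on [0,x₀) ∪ (x₀,1], satisfies w(0)=w(1)=0 and ∫₀¹ p (w')² dx < ∞, one has ∫₀¹ (p(x)/(x-x₀)²) w(x)² dx ≤ C ∫₀¹ p(x) w'(x)² dx. -/

import Mathlib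

open MeasureTheory Set

/-- Pointwise bound from the fundamental theorem of calculus and Cauchy-Schwarz. -/
lemma hardy_pointwise (b δ : ℝ) (hδ : 0 < δ) (u u' : ℝ → ℝ)
    (hm : AEMeasurable u' (volume.restrict (Ioo 0 b)))
    (hder : ∀ t ∈ Ioc 0 b, HasDerivAt u (u' t) t) (hub : u b = 0) (t : ℝ) (ht : t ∈ Ioo 0 b) :
    ENNReal.ofReal (u t ^ 2) ≤ ENNReal.ofReal (t ^ (-δ) / δ) *
      ∫⁻ s in Ioo t b, ENNReal.ofReal (s ^ (1 + δ) * u' s ^ 2) := by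
  have ht0 : 0 < t := ht.1
  have hm' : AEMeasurable u' (volume.restrict (Ioo t b)) :=
    hm.mono_measure (Measure.restrict_mono (Ioo_subset_Ioo_left ht.1.le) le_rfl)
  have h1 : ENNReal.ofReal |u t| ≤ ∫⁻ s in Ioo t b, ENNReal.ofReal |u' s| := by
    by_cases hfin : ∫⁻ s in Ioo t b, ENNReal.ofReal |u' s| = ⊤
    · rw [hfin]; exact le_top
    have hint : IntegrableOn u' (Ioo t b) := by
      refine ⟨hm'.aestronglyMeasurable, ?_⟩
      rw [hasFiniteIntegral_iff_norm]
      exact lt_top_iff_ne_top.2 hfin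
    have hint' : IntegrableOn u' (Ioc t b) := (integrableOn_Ioc_iff_integrableOn_Ioo).2 hint
    have hftc : ∫ s in t..b, u' s = u b - u t := by
      apply intervalIntegral.integral_eq_sub_of_hasDerivAt
      · intro x hx
        rw [uIcc_of_le ht.2.le] at hx
        exact hder x ⟨ht0.trans_le hx.1, hx.2⟩
      · exact (intervalIntegrable_iff_integrableOn_Ioc_of_le ht.2.le).2 hint'
    have : |u t| ≤ ∫ s in Ioo t b, |u' s| := by
      have h2 : u t = - ∫ s in Ioo t b, u' s := by
        rw [← integral_Ioc_eq_integral_Ioo, ← intervalIntegral.integral_of_le ht.2.le, hftc, hub]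
        ring
      rw [h2, abs_neg]
      exact abs_integral_le_integral_abs
    calc ENNReal.ofReal |u t| ≤ ENNReal.ofReal (∫ s in Ioo t b, |u' s|) :=
          ENNReal.ofReal_le_ofReal this
      _ = _ := by
          rw [ofReal_integral_eq_lintegral_ofReal hint.abs]
          exact Filter.Eventually.of_forall fun _ => abs_nonneg _
  have h2 : ∫⁻ s in Ioo t b, ENNReal.ofReal |u' s| ≤
      (∫⁻ s in Ioo t b, ENNReal.ofReal (s ^ (-(1+δ)))) ^ (1/(2:ℝ)) *
      (∫⁻ s in Ioo t b, ENNReal.ofReal (s ^ (1 + δ) * u' s ^ 2)) ^ (1/(2:ℝ)) := by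
    have hh : (2:ℝ).HolderConjugate 2 := Real.HolderConjugate.two_two
    have := ENNReal.lintegral_mul_le_Lp_mul_Lq (volume.restrict (Ioo t b)) hh
      (f := fun s => ENNReal.ofReal (s ^ (-(1+δ)/2)))
      (g := fun s => ENNReal.ofReal (s ^ ((1+δ)/2) * |u' s|))
      (by fun_prop)
      (((measurable_id.pow_const _).aemeasurable.mul
        (continuous_abs.measurable.comp_aemeasurable hm')).ennreal_ofReal)
    convert this using 1
    · refine setLIntegral_congr_fun measurableSet_Ioo fun s hs => ?_
      have hs0 : 0 < s := ht0.trans hs.1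
      simp only [Pi.mul_apply]
      rw [← ENNReal.ofReal_mul (by positivity), ← mul_assoc, ← Real.rpow_add hs0]
      ring_nf
      simp
    · congr 2
      · refine setLIntegral_congr_fun measurableSet_Ioo fun s hs => ?_
        have hs0 : 0 < s := ht0.trans hs.1
        rw [ENNReal.ofReal_rpow_of_nonneg (by positivity) (by norm_num), ← Real.rpow_mul hs0.le]
        ring_nf
      · refine setLIntegral_congr_fun measurableSet_Ioo fun s hs => ?_
        have hs0 : 0 < s := ht0.trans hs.1
        rw [ENNReal.ofReal_rpow_of_nonneg (by positivity) (by norm_num),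
          Real.mul_rpow (by positivity) (by positivity), ← Real.rpow_mul hs0.le]
        norm_num
  have h3 : ∫⁻ s in Ioo t b, ENNReal.ofReal (s ^ (-(1+δ))) ≤ ENNReal.ofReal (t ^ (-δ) / δ) := by
    calc _ ≤ ∫⁻ s in Ioi t, ENNReal.ofReal (s ^ (-(1+δ))) :=
          lintegral_mono_set Ioo_subset_Ioi_self
      _ = ENNReal.ofReal (∫ s in Ioi t, s ^ (-(1+δ))) := by
          rw [ofReal_integral_eq_lintegral_ofReal]
          · exact integrableOn_Ioi_rpow_of_lt (by linarith) ht0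
          · refine (ae_restrict_iff' measurableSet_Ioi).2 (Filter.Eventually.of_forall ?_)
            intro s hs
            exact Real.rpow_nonneg (ht0.trans hs).le _
      _ = _ := by
          rw [integral_Ioi_rpow_of_lt (by linarith) ht0]
          have e : -(1 + δ) + 1 = -δ := by ring
          rw [e, neg_div_neg_eq]
  calc ENNReal.ofReal (u t ^ 2) = (ENNReal.ofReal |u t|) ^ (2:ℝ) := by
        rw [ENNReal.ofReal_rpow_of_nonneg (abs_nonneg _) (by norm_num)]; simp
    _ ≤ ((∫⁻ s in Ioo t b, ENNReal.ofReal (s ^ (-(1+δ)))) ^ (1/(2:ℝ)) *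
      (∫⁻ s in Ioo t b, ENNReal.ofReal (s ^ (1 + δ) * u' s ^ 2)) ^ (1/(2:ℝ))) ^ (2:ℝ) :=
        ENNReal.rpow_le_rpow (h1.trans h2) (by norm_num)
    _ = (∫⁻ s in Ioo t b, ENNReal.ofReal (s ^ (-(1+δ)))) *
      (∫⁻ s in Ioo t b, ENNReal.ofReal (s ^ (1 + δ) * u' s ^ 2)) := by
        rw [ENNReal.mul_rpow_of_nonneg _ _ (by norm_num), ← ENNReal.rpow_mul, ← ENNReal.rpow_mul]
        norm_num
    _ ≤ _ := by gcongr

/-- Inner weight integral. -/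
lemma hardy_inner (b δ : ℝ) (hδ : 0 < δ) (P : ℝ → ℝ)
    (hP : ∀ t ∈ Ioc 0 b, 0 ≤ P t)
    (hmono : MonotoneOn (fun t => P t / t ^ (1 + 2 * δ)) (Ioc 0 b)) (s : ℝ) (hs : s ∈ Ioo 0 b) :
    ∫⁻ t in Ioo 0 s, ENNReal.ofReal (P t / t ^ 2 * (t ^ (-δ) / δ)) ≤
      ENNReal.ofReal (P s / s ^ (1 + δ) / δ ^ 2) := by
  have hs0 : 0 < s := hs.1
  have hPs := hP s ⟨hs.1, hs.2.le⟩
  have hint : IntegrableOn (fun t : ℝ => t ^ (δ - 1)) (Ioo 0 s) := by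
    rw [← integrableOn_Ioc_iff_integrableOn_Ioo, ← intervalIntegrable_iff_integrableOn_Ioc_of_le hs0.le]
    exact intervalIntegral.intervalIntegrable_rpow' (by linarith)
  calc _ ≤ ∫⁻ t in Ioo 0 s, ENNReal.ofReal (P s / s ^ (1 + 2 * δ) / δ * t ^ (δ - 1)) := by
        refine setLIntegral_mono' measurableSet_Ioo fun t ht => ENNReal.ofReal_le_ofReal ?_
        have ht0 : 0 < t := ht.1
        have h := hmono ⟨ht.1, ht.2.le.trans hs.2.le⟩ ⟨hs.1, hs.2.le⟩ ht.2.le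
        simp only at h
        have e : P t / t ^ 2 * (t ^ (-δ) / δ) = P t / t ^ (1 + 2 * δ) / δ * t ^ (δ - 1) := by
          have e1 : t ^ (1 + 2 * δ) = t ^ 2 * t ^ δ * t ^ (δ - 1) := by
            rw [← Real.rpow_natCast t 2, ← Real.rpow_add ht0, ← Real.rpow_add ht0]
            congr 1; push_cast; ring
          rw [e1, Real.rpow_neg ht0.le]
          have := Real.rpow_pos_of_pos ht0 δ
          have := Real.rpow_pos_of_pos ht0 (δ - 1)
          field_simp
        rw [e]
        gcongr
    _ = ENNReal.ofReal (∫ t in Ioo 0 s, P s / s ^ (1 + 2 * δ) / δ * t ^ (δ - 1)) := by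
        rw [ofReal_integral_eq_lintegral_ofReal]
        · exact hint.const_mul _
        · refine (ae_restrict_iff' measurableSet_Ioo).2 (Filter.Eventually.of_forall ?_)
          intro t ht
          have ht0 : 0 < t := ht.1
          simp only [Pi.zero_apply]
          positivity
    _ = _ := by
        congr 1
        rw [integral_const_mul, ← integral_Ioc_eq_integral_Ioo,
          ← intervalIntegral.integral_of_le hs0.le, integral_rpow (Or.inl (by linarith))]
        have e1 : s ^ (1 + 2 * δ) = s ^ (1 + δ) * s ^ δ := by
          rw [← Real.rpow_add hs0]; congr 1; ring
        have := Real.rpow_pos_of_pos hs0 δ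
        have := Real.rpow_pos_of_pos hs0 (1 + δ)
        rw [e1, sub_add_cancel, Real.zero_rpow hδ.ne', sub_zero]
        field_simp

lemma hardy_half (b δ : ℝ) (hδ : 0 < δ) (P u u' : ℝ → ℝ)
    (hP : ∀ t ∈ Ioc 0 b, 0 ≤ P t)
    (hmono : MonotoneOn (fun t => P t / t ^ (1 + 2 * δ)) (Ioc 0 b))
    (hder : ∀ t ∈ Ioc 0 b, HasDerivAt u (u' t) t) (hub : u b = 0) :
    ∫⁻ t in Ioo 0 b, ENNReal.ofReal (P t / t ^ 2 * u t ^ 2) ≤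
      ENNReal.ofReal (1 / δ ^ 2) * ∫⁻ t in Ioo 0 b, ENNReal.ofReal (P t * u' t ^ 2) := by
  have hm : AEMeasurable u' (volume.restrict (Ioo 0 b)) := by
    refine (measurable_deriv u).aemeasurable.congr ?_
    refine (ae_restrict_iff' measurableSet_Ioo).2 (Filter.Eventually.of_forall ?_)
    intro t ht
    exact (hder t ⟨ht.1, ht.2.le⟩).deriv
  have hg : AEMeasurable (fun t => P t / t ^ (1 + 2 * δ)) (volume.restrict (Ioo 0 b)) :=
    aemeasurable_restrict_of_monotoneOn measurableSet_Ioo (hmono.mono Ioo_subset_Ioc_self)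
  have hPm : AEMeasurable P (volume.restrict (Ioo 0 b)) := by
    refine (hg.mul ((measurable_id.pow_const (1 + 2 * δ)).aemeasurable)).congr ?_
    refine (ae_restrict_iff' measurableSet_Ioo).2 (Filter.Eventually.of_forall ?_)
    intro t ht
    have := Real.rpow_pos_of_pos ht.1 (1 + 2 * δ)
    simp only [Pi.mul_apply, id]
    field_simp
  set A : ℝ → ENNReal := fun t => ENNReal.ofReal (P t / t ^ 2 * (t ^ (-δ) / δ)) with hA
  set B : ℝ → ENNReal := fun s => ENNReal.ofReal (s ^ (1 + δ) * u' s ^ 2) with hB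
  have hAm : AEMeasurable A (volume.restrict (Ioo 0 b)) := by
    refine AEMeasurable.ennreal_ofReal ?_
    exact (hPm.div (by fun_prop)).mul (by fun_prop)
  have hBm : AEMeasurable B (volume.restrict (Ioo 0 b)) := by
    refine AEMeasurable.ennreal_ofReal ?_
    exact AEMeasurable.mul (by fun_prop) (hm.pow_const _)
  have hK : Measurable (fun z : ℝ × ℝ => {z : ℝ × ℝ | z.1 < z.2}.indicator (fun _ => (1 : ENNReal)) z) :=
    measurable_const.indicator (measurableSet_lt measurable_fst measurable_snd)
  set K : ℝ → ℝ → ENNReal := fun t s => {z : ℝ × ℝ | z.1 < z.2}.indicator (fun _ => 1) (t, s) with hKdef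
  calc _ ≤ ∫⁻ t in Ioo 0 b, ∫⁻ s in Ioo 0 b, A t * B s * K t s := by
        refine setLIntegral_mono' measurableSet_Ioo fun t ht => ?_
        have h := hardy_pointwise b δ hδ u u' hm hder hub t ht
        have hPt := hP t ⟨ht.1, ht.2.le⟩
        have ht0 : 0 < t := ht.1
        rw [ENNReal.ofReal_mul (by positivity)]
        refine (mul_le_mul_right h _).trans ?_
        rw [← mul_assoc, ← ENNReal.ofReal_mul (by positivity)]
        rw [← lintegral_const_mul' _ _ ENNReal.ofReal_ne_top]
        rw [← lintegral_indicator measurableSet_Ioo, ← lintegral_indicator measurableSet_Ioo]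
        refine lintegral_mono fun s => ?_
        by_cases hs : s ∈ Ioo t b
        · have hs' : s ∈ Ioo 0 b := ⟨ht0.trans hs.1, hs.2⟩
          have : K t s = 1 := by simp [hKdef, hs.1]
          simp [hs, hs', this, hA, hB]
        · simp [hs]
    _ = ∫⁻ s in Ioo 0 b, ∫⁻ t in Ioo 0 b, A t * B s * K t s := by
        refine lintegral_lintegral_swap ?_
        exact (hAm.comp_fst.mul hBm.comp_snd).mul hK.aemeasurable
    _ ≤ ∫⁻ s in Ioo 0 b, ENNReal.ofReal (1 / δ ^ 2) * ENNReal.ofReal (P s * u' s ^ 2) := by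
        refine setLIntegral_mono' measurableSet_Ioo fun s hs => ?_
        have h := hardy_inner b δ hδ P hP hmono s hs
        have hs0 : 0 < s := hs.1
        have hPs := hP s ⟨hs.1, hs.2.le⟩
        calc _ ≤ ∫⁻ t in Ioo 0 s, B s * A t := by
              rw [← lintegral_indicator measurableSet_Ioo, ← lintegral_indicator measurableSet_Ioo]
              refine lintegral_mono fun t => ?_
              by_cases ht : t ∈ Ioo 0 b
              · by_cases hts : t < s
                · have : t ∈ Ioo 0 s := ⟨ht.1, hts⟩
                  simp [ht, this, hKdef, hts, mul_comm]
                · simp [ht, hKdef, hts]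
              · simp [ht]
          _ = B s * ∫⁻ t in Ioo 0 s, A t := lintegral_const_mul' _ _ ENNReal.ofReal_ne_top
          _ ≤ B s * ENNReal.ofReal (P s / s ^ (1 + δ) / δ ^ 2) := by gcongr
          _ = _ := by
              simp only [hB]
              rw [← ENNReal.ofReal_mul (by positivity), ← ENNReal.ofReal_mul (by positivity)]
              congr 1
              have := Real.rpow_pos_of_pos hs0 (1 + δ)
              field_simp
    _ = _ := lintegral_const_mul' _ _ ENNReal.ofReal_ne_top

lemma lint_right (x₀ : ℝ) (f : ℝ → ENNReal) :
    ∫⁻ x in Ioo x₀ 1, f x = ∫⁻ t in Ioo 0 (1 - x₀), f (x₀ + t) := by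
  rw [← lintegral_indicator measurableSet_Ioo, ← lintegral_indicator measurableSet_Ioo,
    ← lintegral_add_left_eq_self _ x₀]
  refine lintegral_congr fun t => ?_
  have : x₀ + t ∈ Ioo x₀ 1 ↔ t ∈ Ioo 0 (1 - x₀) := by
    simp only [mem_Ioo]; constructor <;> rintro ⟨h1, h2⟩ <;> constructor <;> linarith
  by_cases h : t ∈ Ioo 0 (1 - x₀)
  · rw [indicator_of_mem h, indicator_of_mem (this.2 h)]
  · rw [indicator_of_notMem h, indicator_of_notMem (fun h' => h (this.1 h'))]

lemma lint_left (x₀ : ℝ) (f : ℝ → ENNReal) :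
    ∫⁻ x in Ioo 0 x₀, f x = ∫⁻ t in Ioo 0 x₀, f (x₀ - t) := by
  rw [← lintegral_indicator measurableSet_Ioo, ← lintegral_indicator measurableSet_Ioo,
    ← lintegral_sub_left_eq_self _ x₀]
  refine lintegral_congr fun t => ?_
  have : x₀ - t ∈ Ioo 0 x₀ ↔ t ∈ Ioo 0 x₀ := by
    simp only [mem_Ioo]; constructor <;> rintro ⟨h1, h2⟩ <;> constructor <;> linarith
  by_cases h : t ∈ Ioo 0 x₀
  · rw [indicator_of_mem h, indicator_of_mem (this.2 h)]
  · rw [indicator_of_notMem h, indicator_of_notMem (fun h' => h (this.1 h'))]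

lemma lint_split (x₀ : ℝ) (hx₀ : x₀ ∈ Ioo (0:ℝ) 1) (f : ℝ → ENNReal) :
    ∫⁻ x in Ioo 0 1, f x = (∫⁻ x in Ioo 0 x₀, f x) + ∫⁻ x in Ioo x₀ 1, f x := by
  rw [← Ioo_union_Ico_eq_Ioo hx₀.1 hx₀.2.le, lintegral_union measurableSet_Ico]
  · rw [setLIntegral_congr (Ioo_ae_eq_Ico (a := x₀) (b := 1) (μ := volume))]
  · exact disjoint_left.2 fun x h1 h2 => absurd h1.2 (not_lt.2 h2.1)

/-- Proposition 1.5 (Hardy–Poincaré inequality with interior-degenerate weight). -/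
theorem stmt4 (p : ℝ → ℝ) (x₀ : ℝ)
    (hx₀ : x₀ ∈ Set.Ioo (0:ℝ) 1)
    (hp_cont : ContinuousOn p (Set.Icc 0 1))
    (hp_pos : ∀ x ∈ Set.Icc (0:ℝ) 1, x ≠ x₀ → 0 < p x)
    (hp_zero : p x₀ = 0)
    (hq : ∃ q ∈ Set.Ioo (1:ℝ) 2,
      AntitoneOn (fun x => p x / |x - x₀| ^ q) (Set.Ico 0 x₀) ∧
      MonotoneOn (fun x => p x / |x - x₀| ^ q) (Set.Ioc x₀ 1)) :
    ∃ C > 0, ∀ (w w' : ℝ → ℝ),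
      (∀ x ∈ Set.Icc (0:ℝ) 1 \ {x₀}, HasDerivAt w (w' x) x) →
      w 0 = 0 → w 1 = 0 →
      MeasureTheory.IntegrableOn (fun x => p x * (w' x) ^ 2) (Set.Ioo 0 1) →
      ∫⁻ x in Set.Ioo (0:ℝ) 1, ENNReal.ofReal (p x / (x - x₀) ^ 2 * (w x) ^ 2) ≤
        ENNReal.ofReal C * ∫⁻ x in Set.Ioo (0:ℝ) 1, ENNReal.ofReal (p x * (w' x) ^ 2) := by
  obtain ⟨q, hq1, hanti, hmono⟩ := hq
  obtain ⟨δ, hδ⟩ : ∃ δ, q = 1 + 2 * δ := ⟨(q - 1) / 2, by ring⟩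
  subst hδ
  have hδ : 0 < δ := by linarith [hq1.1]
  refine ⟨1 / δ ^ 2, by positivity, fun w w' hder hw0 hw1 _ => ?_⟩
  have hp0 : ∀ x ∈ Icc (0:ℝ) 1, 0 ≤ p x := fun x hx => by
    by_cases h : x = x₀
    · rw [h, hp_zero]
    · exact (hp_pos x hx h).le
  have hR := hardy_half (1 - x₀) δ hδ (fun t => p (x₀ + t)) (fun t => w (x₀ + t))
    (fun t => w' (x₀ + t))
    (fun t ht => hp0 _ ⟨by linarith [ht.1, hx₀.1], by linarith [ht.2]⟩)
    (by
      intro s hs t ht hst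
      have := hmono (a := x₀ + s) (b := x₀ + t) ⟨by linarith [hs.1], by linarith [hs.2]⟩
        ⟨by linarith [ht.1], by linarith [ht.2]⟩ (by linarith)
      simpa [abs_of_pos hs.1, abs_of_pos ht.1] using this)
    (by
      intro t ht
      have h := hder (x₀ + t) ⟨⟨by linarith [ht.1, hx₀.1], by linarith [ht.2]⟩, by
        simpa using ht.1.ne'⟩
      simpa using h.comp_const_add x₀ t)
    (by simpa using hw1)
  have hL := hardy_half x₀ δ hδ (fun t => p (x₀ - t)) (fun t => w (x₀ - t))
    (fun t => - w' (x₀ - t))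
    (fun t ht => hp0 _ ⟨by linarith [ht.2], by linarith [ht.1, hx₀.2]⟩)
    (by
      intro s hs t ht hst
      have := hanti (a := x₀ - t) (b := x₀ - s) ⟨by linarith [ht.2], by linarith [ht.1]⟩
        ⟨by linarith [hs.2], by linarith [hs.1]⟩ (by linarith)
      simpa [abs_of_pos hs.1, abs_of_pos ht.1] using this)
    (by
      intro t ht
      have h := hder (x₀ - t) ⟨⟨by linarith [ht.2], by linarith [ht.1, hx₀.2]⟩, by
        simpa using ht.1.ne'⟩
      simpa using h.comp_const_sub x₀ t)
    (by simpa using hw0)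
  rw [lint_split x₀ hx₀, lint_split x₀ hx₀ (fun x => ENNReal.ofReal (p x * (w' x) ^ 2)), mul_add,
    lint_left x₀, lint_left x₀ (fun x => ENNReal.ofReal (p x * (w' x) ^ 2)),
    lint_right x₀, lint_right x₀ (fun x => ENNReal.ofReal (p x * (w' x) ^ 2))]
  refine add_le_add ?_ ?_
  · simpa using hL
  · simpa using hR
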